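/- Let n ≥ 2 and 2 ≤ r ≤ n, let G = ℤ_{rn²}, and set S = {rn·i : 0 ≤ i < n}, T = {(r−1)·i : 0 ≤ i < n}, U = {r·i : 0 ≤ i < n} (subsets of G). Given any A, B ∈ ℝ^{n×n}, let σ, τ, υ : {0,…,n−1} → {0,…,n−1} be independent uniformly random permutations and α, β, γ ∈ {±1}ⁿ independent uniform sign vectors (all mutually independent). Define a, b : G → ℝ by a(g) = Σ_{(i,k) : rn·σ(i)+(r−1)·τ(k) = g} α_i·γ_k·A_{i,k} and b(g) = Σ_{(l,j) : −(r−1)·τ(l)+r·υ(j) = g} γ_l·β_j·B_{l,j}, let c(g) = Σ_{h∈G} a(h)·b(g−h), and define C ∈ ℝ^{n×n} by C_{i,j} = α_i·β_j·c(rn·σ(i)+r·υ(j)). Then there exists an absolute constant C₀ (independent of n, r, A, B) such that E[‖C − AB‖_F²] ≤ C₀·((ρ_{n,G}(S,T,U) − n³)/n⁴)·‖A‖_F²·‖B‖_F². -/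

import Mathlib

/-- The sign `±1` associated to a Boolean. -/
noncomputable def sgn (x : Bool) : ℝ := if x then 1 else -1

/-- `S = {rn·i : 0 ≤ i < n} ⊆ ℤ_{rn²}`. -/
def Sset (n r : ℕ) : Finset (ZMod (r * n ^ 2)) :=
  (Finset.range n).image (fun i => ((r * n * i : ℕ) : ZMod (r * n ^ 2)))

/-- `T = {(r-1)·i : 0 ≤ i < n} ⊆ ℤ_{rn²}`. -/
def Tset (n r : ℕ) : Finset (ZMod (r * n ^ 2)) :=
  (Finset.range n).image (fun i => (((r - 1) * i : ℕ) : ZMod (r * n ^ 2)))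

/-- `U = {r·i : 0 ≤ i < n} ⊆ ℤ_{rn²}`. -/
def Uset (n r : ℕ) : Finset (ZMod (r * n ^ 2)) :=
  (Finset.range n).image (fun i => ((r * i : ℕ) : ZMod (r * n ^ 2)))

/-- The approximate triple product quantity `ρ_{n,G}(S,T,U)` for `G = ℤ_{rn²}`:
the number of 6-tuples `(s₁,s₂,t₁,t₂,u₁,u₂) ∈ S²×T²×U²` with
`s₁ - s₂ + t₁ - t₂ = u₁ - u₂`. -/
def rhoSTU (n r : ℕ) : ℕ :=
  ((Sset n r ×ˢ Sset n r ×ˢ Tset n r ×ˢ Tset n r ×ˢ Uset n r ×ˢ Uset n r).filter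
      (fun p : ZMod (r * n ^ 2) × ZMod (r * n ^ 2) × ZMod (r * n ^ 2) ×
          ZMod (r * n ^ 2) × ZMod (r * n ^ 2) × ZMod (r * n ^ 2) =>
        p.1 - p.2.1 + p.2.2.1 - p.2.2.2.1 = p.2.2.2.2.1 - p.2.2.2.2.2)).card

/-- The entry `C_{i,j} = α_i β_j c(rn·σ(i) + r·υ(j))` of the randomized PolyForm output,
where `c = a ∗ b` is the cyclic convolution in `ℤ_{rn²}` of the embedded signals
`a(g) = Σ_{(i,k) : rn·σ(i)+(r−1)·τ(k)=g} α_i γ_k A_{i,k}` and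
`b(g) = Σ_{(l,j) : −(r−1)·τ(l)+r·υ(j)=g} γ_l β_j B_{l,j}`. -/
noncomputable def polyFormC (n r : ℕ) [NeZero (r * n ^ 2)]
    (A B : Fin n → Fin n → ℝ) (σ τ υ : Equiv.Perm (Fin n)) (α β γ : Fin n → Bool)
    (i j : Fin n) : ℝ :=
  sgn (α i) * sgn (β j) *
    ∑ h : ZMod (r * n ^ 2),
      (∑ p : Fin n × Fin n,
        if ((r * n * (σ p.1 : ℕ) + (r - 1) * (τ p.2 : ℕ) : ℕ) : ZMod (r * n ^ 2)) = h
        then sgn (α p.1) * sgn (γ p.2) * A p.1 p.2 else 0) *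
      (∑ q : Fin n × Fin n,
        if ((r * (υ q.2 : ℕ) : ℕ) : ZMod (r * n ^ 2))
              - (((r - 1) * (τ q.1 : ℕ) : ℕ) : ZMod (r * n ^ 2))
            = ((r * n * (σ i : ℕ) + r * (υ j : ℕ) : ℕ) : ZMod (r * n ^ 2)) - h
        then sgn (γ q.1) * sgn (β q.2) * B q.1 q.2 else 0)

namespace PF
open Finset

lemma sgn_mul_self' (b : Bool) : sgn b * sgn b = 1 := by cases b <;> simp [sgn]

lemma sgn_not' (b : Bool) : sgn (!b) = - sgn b := by cases b <;> simp [sgn]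

/-- Flipping one coordinate of a sign vector. -/
def flipAt {n : ℕ} (m : Fin n) (γ : Fin n → Bool) : Fin n → Bool := Function.update γ m (!(γ m))

lemma flipAt_inv {n : ℕ} (m : Fin n) : Function.Involutive (flipAt m) := by
  intro γ
  funext t
  by_cases h : t = m
  · subst h; simp [flipAt]
  · simp [flipAt, h]

lemma sgn_flip_same {n : ℕ} (m : Fin n) (γ : Fin n → Bool) : sgn (flipAt m γ m) = - sgn (γ m) := by
  simp [flipAt, sgn_not']

lemma sgn_flip_ne {n : ℕ} {m t : Fin n} (h : t ≠ m) (γ : Fin n → Bool) :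
    sgn (flipAt m γ t) = sgn (γ t) := by
  simp [flipAt, h]

lemma sum_flip_zero {n : ℕ} (m : Fin n) (f : (Fin n → Bool) → ℝ)
    (h : ∀ γ, f (flipAt m γ) = - f γ) : ∑ γ, f γ = 0 := by
  have h1 : ∑ γ, f (flipAt m γ) = ∑ γ, f γ :=
    Equiv.sum_comp (Function.Involutive.toPerm _ (flipAt_inv m)) f
  simp only [h, Finset.sum_neg_distrib] at h1
  linarith

lemma sum_sgn_two {n : ℕ} (k l : Fin n) :
    ∑ γ : Fin n → Bool, sgn (γ k) * sgn (γ l) = if k = l then (2:ℝ)^n else 0 := by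
  split_ifs with h
  · subst h
    simp [sgn_mul_self']
  · apply sum_flip_zero k
    intro γ
    rw [sgn_flip_same, sgn_flip_ne (Ne.symm h)]
    ring

lemma rademacher {n : ℕ} (f : Fin n → ℝ) :
    ∑ α : Fin n → Bool, (∑ i, sgn (α i) * f i) ^ 2 = 2 ^ n * ∑ i, f i ^ 2 := by
  have h1 : ∀ α : Fin n → Bool, (∑ i, sgn (α i) * f i) ^ 2
      = ∑ i, ∑ j, (sgn (α i) * sgn (α j)) * (f i * f j) := by
    intro α
    rw [sq, Finset.sum_mul_sum]
    refine Finset.sum_congr rfl fun i _ => Finset.sum_congr rfl fun j _ => by ring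
  simp_rw [h1]
  rw [Finset.sum_comm]
  simp_rw [Finset.sum_comm (s := (univ : Finset (Fin n → Bool))), ← Finset.sum_mul, sum_sgn_two]
  simp [Finset.mul_sum, sq]

lemma sum_sgn_four {n : ℕ} (k l k' l' : Fin n) (h : k ≠ l) (h' : k' ≠ l') :
    ∑ γ : Fin n → Bool, (sgn (γ k) * sgn (γ l)) * (sgn (γ k') * sgn (γ l'))
      = 2 ^ n * ((if k = k' ∧ l = l' then (1:ℝ) else 0) + (if k = l' ∧ l = k' then 1 else 0)) := by
  by_cases h1 : k = k'
  · subst h1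
    by_cases h2 : l = l'
    · subst h2
      have : ∀ γ : Fin n → Bool, (sgn (γ k) * sgn (γ l)) * (sgn (γ k) * sgn (γ l)) = 1 := by
        intro γ
        rw [mul_mul_mul_comm, sgn_mul_self', sgn_mul_self', one_mul]
      simp [this, h]
    · simp only [h2, h', and_false, false_and, if_false, add_zero, mul_zero]
      apply sum_flip_zero l
      intro γ
      rw [sgn_flip_same, sgn_flip_ne h, sgn_flip_ne (Ne.symm h2)]
      ring
  · by_cases h2 : k = l'
    · subst h2
      by_cases h3 : l = k'
      · subst h3
        have : ∀ γ : Fin n → Bool, (sgn (γ k) * sgn (γ l)) * (sgn (γ l) * sgn (γ k)) = 1 := by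
          intro γ
          rw [mul_comm (sgn (γ l)), mul_mul_mul_comm, sgn_mul_self', sgn_mul_self', one_mul]
        simp [this, h]
      · simp only [h1, h3, and_false, false_and, if_false, add_zero, mul_zero]
        apply sum_flip_zero l
        intro γ
        rw [sgn_flip_same, sgn_flip_ne h, sgn_flip_ne (Ne.symm h3)]
        ring
    · simp only [h1, h2, false_and, if_false, add_zero, mul_zero]
      apply sum_flip_zero k
      intro γ
      rw [sgn_flip_same, sgn_flip_ne (Ne.symm h), sgn_flip_ne (Ne.symm h1),
        sgn_flip_ne (Ne.symm h2)]
      ring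

lemma chaos {n : ℕ} (x : Fin n → Fin n → ℝ) (hx : ∀ k, x k k = 0) :
    ∑ γ : Fin n → Bool, (∑ k, ∑ l, sgn (γ k) * sgn (γ l) * x k l) ^ 2
      ≤ 2 * 2 ^ n * ∑ k, ∑ l, x k l ^ 2 := by
  have h1 : ∀ γ : Fin n → Bool, (∑ k, ∑ l, sgn (γ k) * sgn (γ l) * x k l) ^ 2
      = ∑ p : Fin n × Fin n, ∑ q : Fin n × Fin n,
        ((sgn (γ p.1) * sgn (γ p.2)) * (sgn (γ q.1) * sgn (γ q.2))) *
          (x p.1 p.2 * x q.1 q.2) := by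
    intro γ
    rw [← Fintype.sum_prod_type', sq, Finset.sum_mul_sum]
    refine Finset.sum_congr rfl fun i _ => Finset.sum_congr rfl fun j _ => by ring
  simp_rw [h1]
  rw [Finset.sum_comm]
  simp_rw [Finset.sum_comm (s := (univ : Finset (Fin n → Bool))), ← Finset.sum_mul]
  have h2 : ∀ p q : Fin n × Fin n,
      (∑ γ : Fin n → Bool, (sgn (γ p.1) * sgn (γ p.2)) * (sgn (γ q.1) * sgn (γ q.2))) *
          (x p.1 p.2 * x q.1 q.2)
      = (if p = q then 2 ^ n * (x p.1 p.2 * x q.1 q.2) else 0)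
        + (if q = p.swap then 2 ^ n * (x p.1 p.2 * x q.1 q.2) else 0) := by
    rintro ⟨k, l⟩ ⟨k', l'⟩
    by_cases h : k = l
    · subst h; simp [hx]
    by_cases h' : k' = l'
    · subst h'; simp [hx]
    rw [sum_sgn_four k l k' l' h h']
    simp only [Prod.mk.injEq, Prod.swap_prod_mk]
    have e : (k' = l ∧ l' = k) ↔ (k = l' ∧ l = k') := by
      constructor <;> (rintro ⟨rfl, rfl⟩; simp)
    simp only [e]
    split_ifs <;> ring
  simp_rw [h2, Finset.sum_add_distrib]
  simp only [Finset.sum_ite_eq, Finset.sum_ite_eq', Finset.mem_univ, if_true, Prod.fst_swap,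
    Prod.snd_swap]
  rw [← Fintype.sum_prod_type' (f := fun k l => x k l ^ 2)]
  have h3 : ∑ p : Fin n × Fin n, x p.2 p.1 ^ 2 = ∑ p : Fin n × Fin n, x p.1 p.2 ^ 2 :=
    Equiv.sum_comp (Equiv.prodComm (Fin n) (Fin n)) (fun p => x p.1 p.2 ^ 2)
  rw [← Finset.mul_sum, ← Finset.mul_sum]
  have h4 : ∑ p : Fin n × Fin n, x p.1 p.2 * x p.2 p.1 ≤ ∑ p : Fin n × Fin n, x p.1 p.2 ^ 2 := by
    have : ∑ p : Fin n × Fin n, x p.1 p.2 * x p.2 p.1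
        ≤ ∑ p : Fin n × Fin n, (x p.1 p.2 ^ 2 + x p.2 p.1 ^ 2) / 2 :=
      Finset.sum_le_sum fun p _ => by nlinarith [sq_nonneg (x p.1 p.2 - x p.2 p.1)]
    rw [← Finset.sum_div, Finset.sum_add_distrib, h3] at this
    linarith
  have h5 : (0:ℝ) < 2 ^ n := by positivity
  have h6 : ∑ p : Fin n × Fin n, x p.1 p.2 * x p.1 p.2 = ∑ p : Fin n × Fin n, x p.1 p.2 ^ 2 :=
    Finset.sum_congr rfl fun p _ => by ring
  rw [h6]
  nlinarith

lemma perm_one {n : ℕ} (i : Fin n) (f : Fin n → ℝ) :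
    (n : ℝ) * ∑ σ : Equiv.Perm (Fin n), f (σ i) = (n.factorial : ℝ) * ∑ a, f a := by
  have h1 : ∀ i', ∑ σ : Equiv.Perm (Fin n), f (σ i') = ∑ σ : Equiv.Perm (Fin n), f (σ i) := by
    intro i'
    rw [← Equiv.sum_comp (Equiv.mulRight (Equiv.swap i i')) (fun σ => f (σ i'))]
    simp
  have h2 : ∑ i', ∑ σ : Equiv.Perm (Fin n), f (σ i')
      = (n : ℝ) * ∑ σ : Equiv.Perm (Fin n), f (σ i) := by
    rw [Finset.sum_congr rfl fun i' _ => h1 i']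
    simp
  rw [← h2, Finset.sum_comm]
  simp_rw [fun σ : Equiv.Perm (Fin n) => Equiv.sum_comp σ f]
  simp [Fintype.card_perm]

lemma perm_two {n : ℕ} (k l : Fin n) (hkl : k ≠ l) (g : Fin n → Fin n → ℝ)
    (hg : ∀ a, g a a = 0) :
    (n : ℝ) * ((n : ℝ) - 1) * ∑ τ : Equiv.Perm (Fin n), g (τ k) (τ l)
      = (n.factorial : ℝ) * ∑ a, ∑ b, g a b := by
  have h1 : ∀ l', l' ≠ k → ∑ τ : Equiv.Perm (Fin n), g (τ k) (τ l')
      = ∑ τ : Equiv.Perm (Fin n), g (τ k) (τ l) := by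
    intro l' hl'
    rw [← Equiv.sum_comp (Equiv.mulRight (Equiv.swap l l')) (fun τ => g (τ k) (τ l'))]
    simp [Equiv.swap_apply_of_ne_of_ne hkl hl'.symm]
  have h2 : ∑ l', ∑ τ : Equiv.Perm (Fin n), g (τ k) (τ l')
      = ((n : ℝ) - 1) * ∑ τ : Equiv.Perm (Fin n), g (τ k) (τ l) := by
    rw [← Finset.add_sum_erase _ _ (Finset.mem_univ k)]
    rw [Finset.sum_congr rfl fun l' hl' => h1 l' (Finset.ne_of_mem_erase hl')]
    have : 1 ≤ n := k.pos
    simp [hg, Nat.cast_sub this]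
  rw [mul_assoc, ← h2, Finset.sum_comm]
  simp_rw [fun τ : Equiv.Perm (Fin n) => Equiv.sum_comp τ (g (τ k))]
  exact perm_one k (fun a => ∑ b, g a b)

/-- The permutation average. -/
lemma perm_avg {n : ℕ} (w : Fin n → Fin n → Fin n → Fin n → Fin n → Fin n → ℝ)
    (hw : ∀ a a' b c c', w a a' b b c c' = 0) (i' k l j' : Fin n) (hkl : k ≠ l) :
    (n : ℝ) ^ 3 * ((n : ℝ) - 1) *
      ∑ σ : Equiv.Perm (Fin n), ∑ τ : Equiv.Perm (Fin n), ∑ υ : Equiv.Perm (Fin n),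
        ∑ i, ∑ j, w (σ i) (σ i') (τ k) (τ l) (υ j) (υ j')
      = (n.factorial : ℝ) ^ 3 * ∑ a', ∑ b, ∑ b', ∑ c', ∑ a, ∑ c, w a a' b b' c c' := by
  have e1 : ∀ σ τ υ : Equiv.Perm (Fin n), ∑ i, ∑ j, w (σ i) (σ i') (τ k) (τ l) (υ j) (υ j')
      = ∑ a, ∑ c, w a (σ i') (τ k) (τ l) c (υ j') := by
    intro σ τ υ
    rw [← Equiv.sum_comp σ (fun a => ∑ c, w a (σ i') (τ k) (τ l) c (υ j'))]
    refine Finset.sum_congr rfl fun i _ => ?_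
    exact Equiv.sum_comp υ (fun c => w (σ i) (σ i') (τ k) (τ l) c (υ j'))
  simp_rw [e1]
  have e2 : ∀ a' b b', (n : ℝ) * ∑ υ : Equiv.Perm (Fin n), ∑ a, ∑ c, w a a' b b' c (υ j')
      = (n.factorial : ℝ) * ∑ c', ∑ a, ∑ c, w a a' b b' c c' := fun a' b b' =>
    perm_one j' (fun c' => ∑ a, ∑ c, w a a' b b' c c')
  have e3 : ∀ a', (n : ℝ) * ((n : ℝ) - 1) * ∑ τ : Equiv.Perm (Fin n),
      ∑ υ : Equiv.Perm (Fin n), ∑ a, ∑ c, w a a' (τ k) (τ l) c (υ j')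
      = (n.factorial : ℝ) * ∑ b, ∑ b', ∑ υ : Equiv.Perm (Fin n), ∑ a, ∑ c, w a a' b b' c (υ j') :=
    fun a' => perm_two k l hkl
      (fun b b' => ∑ υ : Equiv.Perm (Fin n), ∑ a, ∑ c, w a a' b b' c (υ j')) (by simp [hw])
  have e4 := perm_one i' (fun a' => ∑ τ : Equiv.Perm (Fin n),
      ∑ υ : Equiv.Perm (Fin n), ∑ a, ∑ c, w a a' (τ k) (τ l) c (υ j'))
  calc _ = (n:ℝ) * ((n : ℝ) * ((n : ℝ) - 1)) * ((n:ℝ) * ∑ σ : Equiv.Perm (Fin n),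
        ∑ τ : Equiv.Perm (Fin n), ∑ υ : Equiv.Perm (Fin n),
        ∑ a, ∑ c, w a (σ i') (τ k) (τ l) c (υ j')) := by ring
    _ = n * (n.factorial * ∑ a', ((n : ℝ) * ((n : ℝ) - 1)) * ∑ τ : Equiv.Perm (Fin n),
      ∑ υ : Equiv.Perm (Fin n), ∑ a, ∑ c, w a a' (τ k) (τ l) c (υ j')) := by
        rw [e4, ← Finset.mul_sum]; ring
    _ = n.factorial * (n.factorial * ∑ a', ∑ b, ∑ b', (n:ℝ) * ∑ υ : Equiv.Perm (Fin n),
          ∑ a, ∑ c, w a a' b b' c (υ j')) := by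
        simp_rw [e3, ← Finset.mul_sum]; ring
    _ = _ := by
        simp_rw [e2, ← Finset.mul_sum]; ring

/-- The sign average. -/
lemma sign_avg {n : ℕ} (X : Fin n → Fin n → Fin n → Fin n → ℝ)
    (hX : ∀ i k j, X i k k j = 0) :
    ∑ α : Fin n → Bool, ∑ β : Fin n → Bool, ∑ γ : Fin n → Bool,
      (∑ i, sgn (α i) * ∑ j, sgn (β j) * ∑ k, ∑ l, sgn (γ k) * sgn (γ l) * X i k l j) ^ 2
    ≤ 2 * (2 ^ n) ^ 3 * ∑ i, ∑ j, ∑ k, ∑ l, X i k l j ^ 2 := by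
  rw [Finset.sum_comm]
  have e : ∀ β : Fin n → Bool, ∑ α : Fin n → Bool, ∑ γ : Fin n → Bool,
      (∑ i, sgn (α i) * ∑ j, sgn (β j) * ∑ k, ∑ l, sgn (γ k) * sgn (γ l) * X i k l j) ^ 2
      = ∑ γ : Fin n → Bool, 2 ^ n * ∑ i,
        (∑ j, sgn (β j) * ∑ k, ∑ l, sgn (γ k) * sgn (γ l) * X i k l j) ^ 2 := by
    intro β
    rw [Finset.sum_comm]
    exact Finset.sum_congr rfl fun γ _ => rademacher _
  simp_rw [e]
  rw [Finset.sum_comm]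
  have e2 : ∀ γ : Fin n → Bool, ∑ β : Fin n → Bool, 2 ^ n * ∑ i,
        (∑ j, sgn (β j) * ∑ k, ∑ l, sgn (γ k) * sgn (γ l) * X i k l j) ^ 2
      = 2 ^ n * ∑ i, (2 ^ n * ∑ j, (∑ k, ∑ l, sgn (γ k) * sgn (γ l) * X i k l j) ^ 2) := by
    intro γ
    rw [← Finset.mul_sum, Finset.sum_comm]
    congr 1
    exact Finset.sum_congr rfl fun i _ => rademacher _
  simp_rw [e2, ← Finset.mul_sum]
  rw [Finset.sum_comm]
  have e3 : ∑ i, ∑ γ : Fin n → Bool, ∑ j, (∑ k, ∑ l, sgn (γ k) * sgn (γ l) * X i k l j) ^ 2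
      ≤ ∑ i, ∑ j, 2 * 2 ^ n * ∑ k, ∑ l, X i k l j ^ 2 := by
    refine Finset.sum_le_sum fun i _ => ?_
    rw [Finset.sum_comm]
    exact Finset.sum_le_sum fun j _ => chaos (fun k l => X i k l j) (fun k => hX i k j)
  simp_rw [← Finset.mul_sum] at e3
  calc _ ≤ (2:ℝ) ^ n * (2 ^ n * (2 * 2 ^ n * ∑ i, ∑ j, ∑ k, ∑ l, X i k l j ^ 2)) := by gcongr
    _ = _ := by ring

/-- Uniqueness when the middle coordinates agree. -/
lemma key_inj {n r : ℕ} (hr : 2 ≤ r) {a a' c c' : ℕ} (ha : a < n) (ha' : a' < n)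
    (hc : c < n) (hc' : c' < n)
    (h : ((r * n * a : ℕ) : ZMod (r * n ^ 2)) + ((r * c : ℕ) : ZMod (r * n ^ 2))
      = ((r * n * a' : ℕ) : ZMod (r * n ^ 2)) + ((r * c' : ℕ) : ZMod (r * n ^ 2))) :
    a = a' ∧ c = c' := by
  rw [← Nat.cast_add, ← Nat.cast_add, ZMod.natCast_eq_natCast_iff] at h
  have b : ∀ a c : ℕ, a < n → c < n → r * n * a + r * c < r * n ^ 2 := by
    intro a c ha hc
    have h1 : n * a + c < n ^ 2 := by nlinarith
    calc r * n * a + r * c = r * (n * a + c) := by ring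
      _ < r * n ^ 2 := Nat.mul_lt_mul_of_pos_left h1 (by omega)
  have h2 := Nat.ModEq.eq_of_lt_of_lt h (b a c ha hc) (b a' c' ha' hc')
  have h3 : n * a + c = n * a' + c' := by
    apply Nat.eq_of_mul_eq_mul_left (show 0 < r by omega)
    linarith
  have h4 : a = a' := by
    have := congrArg (· / n) h3
    simpa [Nat.mul_add_div (show 0 < n by omega), Nat.div_eq_of_lt hc, Nat.div_eq_of_lt hc']
      using this
  subst h4
  exact ⟨rfl, by omega⟩

lemma y_inj {n r : ℕ} (hr : 2 ≤ r) {a a' : ℕ} (ha : a < n) (ha' : a' < n)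
    (h : (((r - 1) * a : ℕ) : ZMod (r * n ^ 2)) = (((r - 1) * a' : ℕ) : ZMod (r * n ^ 2))) :
    a = a' := by
  rw [ZMod.natCast_eq_natCast_iff] at h
  have b : ∀ a : ℕ, a < n → (r - 1) * a < r * n ^ 2 := by
    intro a ha
    have : a < n ^ 2 := by nlinarith
    calc (r - 1) * a ≤ r * a := Nat.mul_le_mul_right _ (by omega)
      _ < r * n ^ 2 := Nat.mul_lt_mul_of_pos_left this (by omega)
  have h2 := Nat.ModEq.eq_of_lt_of_lt h (b a ha) (b a' ha')
  exact Nat.eq_of_mul_eq_mul_left (show 0 < r - 1 by omega) h2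

/-- The collision relation. -/
def Coll (n r : ℕ) (a a' b b' c c' : Fin n) : Prop :=
  ((r * n * (a' : ℕ) : ℕ) : ZMod (r * n ^ 2)) - ((r * n * (a : ℕ) : ℕ) : ZMod (r * n ^ 2))
    + (((r - 1) * (b : ℕ) : ℕ) : ZMod (r * n ^ 2)) - (((r - 1) * (b' : ℕ) : ℕ) : ZMod (r * n ^ 2))
    = ((r * (c : ℕ) : ℕ) : ZMod (r * n ^ 2)) - ((r * (c' : ℕ) : ℕ) : ZMod (r * n ^ 2))

lemma coll_diag {n r : ℕ} (hr : 2 ≤ r) (a a' b c c' : Fin n) :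
    Coll n r a a' b b c c' ↔ (a' = a ∧ c' = c) := by
  constructor
  · intro h
    unfold Coll at h
    have := key_inj (n := n) hr a'.2 a.2 c'.2 c.2 (by linear_combination h)
    exact ⟨Fin.ext this.1, Fin.ext this.2⟩
  · rintro ⟨rfl, rfl⟩
    simp [Coll]

open Classical in
/-- Indicator of nontrivial collisions. -/
noncomputable def wInd (n r : ℕ) (a a' b b' c c' : Fin n) : ℝ :=
  if Coll n r a a' b b' c c' ∧ b ≠ b' then 1 else 0

open Classical in
lemma rho_ge (n r : ℕ) (hr : 2 ≤ r) :
    ∑ a' : Fin n, ∑ b : Fin n, ∑ b' : Fin n, ∑ c' : Fin n, ∑ a : Fin n, ∑ c : Fin n,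
      wInd n r a a' b b' c c' = (rhoSTU n r : ℝ) - (n : ℝ) ^ 3 := by
  have h1 : ∀ a a' b b' c c' : Fin n, wInd n r a a' b b' c c'
      = (if Coll n r a a' b b' c c' then (1:ℝ) else 0)
        - (if b = b' then (if a = a' then (if c = c' then 1 else 0) else 0) else 0) := by
    intro a a' b b' c c'
    by_cases hb : b = b'
    · subst hb
      simp only [wInd, coll_diag hr]
      by_cases h1 : a = a' <;> by_cases h2 : c = c' <;> simp [h1, h2, eq_comm]
    · simp [wInd, hb]
  have h2 : (rhoSTU n r : ℝ) = ∑ a' : Fin n, ∑ b : Fin n, ∑ b' : Fin n, ∑ c' : Fin n,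
      ∑ a : Fin n, ∑ c : Fin n, (if Coll n r a a' b b' c c' then (1:ℝ) else 0) := by
    have hS : ∀ f : ZMod (r * n ^ 2) → ℝ, ∑ s ∈ Sset n r, f s
        = ∑ a : Fin n, f ((r * n * (a : ℕ) : ℕ) : ZMod (r * n ^ 2)) := by
      intro f
      rw [Sset, Finset.sum_image, Finset.sum_range]
      intro x hx y hy hxy
      simp only [Finset.coe_range, Set.mem_Iio] at hx hy
      exact (key_inj (n := n) (c := 0) (c' := 0) hr hx hy (by omega) (by omega)
        (by simpa using hxy)).1
    have hU : ∀ f : ZMod (r * n ^ 2) → ℝ, ∑ s ∈ Uset n r, f s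
        = ∑ a : Fin n, f ((r * (a : ℕ) : ℕ) : ZMod (r * n ^ 2)) := by
      intro f
      rw [Uset, Finset.sum_image, Finset.sum_range]
      intro x hx y hy hxy
      simp only [Finset.coe_range, Set.mem_Iio] at hx hy
      exact (key_inj (n := n) (a := 0) (a' := 0) hr (by omega) (by omega) hx hy
        (by simpa using hxy)).2
    have hT : ∀ f : ZMod (r * n ^ 2) → ℝ, ∑ s ∈ Tset n r, f s
        = ∑ a : Fin n, f (((r - 1) * (a : ℕ) : ℕ) : ZMod (r * n ^ 2)) := by
      intro f
      rw [Tset, Finset.sum_image, Finset.sum_range]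
      intro x hx y hy hxy
      simp only [Finset.coe_range, Set.mem_Iio] at hx hy
      exact y_inj hr hx hy hxy
    rw [rhoSTU, Finset.card_filter]
    push_cast
    simp only [Finset.sum_product, hS, hT, hU]
    refine Finset.sum_congr rfl fun a' _ => ?_
    rw [Finset.sum_comm]
    refine Finset.sum_congr rfl fun b _ => ?_
    rw [Finset.sum_comm]
    refine Finset.sum_congr rfl fun b' _ => ?_
    simp_rw [Finset.sum_comm (γ := Fin n) (s := univ) (t := univ)
      (f := fun x y => if _ = ((r * ((x : Fin n) : ℕ) : ℕ) : ZMod (r * n ^ 2))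
        - ((r * ((y : Fin n) : ℕ) : ℕ) : ZMod (r * n ^ 2)) then (1:ℝ) else 0)]
    rw [Finset.sum_comm]
    refine Finset.sum_congr rfl fun c' _ => Finset.sum_congr rfl fun a _ =>
      Finset.sum_congr rfl fun c _ => ?_
    exact if_congr Iff.rfl rfl rfl
  simp_rw [h1, Finset.sum_sub_distrib]
  rw [h2]
  congr 1
  simp [Finset.sum_ite_eq]
  ring

lemma conv_expand {G ι κ : Type*} [AddCommGroup G] [Fintype G] [DecidableEq G] [Fintype ι]
    [Fintype κ] (u : ι → G) (v : κ → G) (f : ι → ℝ) (g : κ → ℝ) (t : G) :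
    ∑ h : G, (∑ p, if u p = h then f p else 0) * (∑ q, if v q = t - h then g q else 0)
      = ∑ p, ∑ q, if v q = t - u p then f p * g q else 0 := by
  simp_rw [Finset.sum_mul]
  rw [Finset.sum_comm]
  refine Finset.sum_congr rfl fun p _ => ?_
  rw [Finset.sum_eq_single (u p)]
  · simp [Finset.mul_sum]
  · intro h _ hne
    simp [hne.symm]
  · simp

lemma err_eq (n r : ℕ) [NeZero (r * n ^ 2)] (hr : 2 ≤ r) (A B : Fin n → Fin n → ℝ)
    (σ τ υ : Equiv.Perm (Fin n)) (α β γ : Fin n → Bool) (i j : Fin n) :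
    polyFormC n r A B σ τ υ α β γ i j - ∑ k : Fin n, A i k * B k j
      = sgn (α i) * sgn (β j) * ∑ i', sgn (α i') * ∑ j', sgn (β j') * ∑ k, ∑ l,
        sgn (γ k) * sgn (γ l) *
          (wInd n r (σ i) (σ i') (τ k) (τ l) (υ j) (υ j') * (A i' k * B l j')) := by
  classical
  unfold polyFormC
  rw [conv_expand]
  have e1 : ∀ i' k l j', (if ((r * (υ j' : ℕ) : ℕ) : ZMod (r * n ^ 2))
              - (((r - 1) * (τ l : ℕ) : ℕ) : ZMod (r * n ^ 2))
            = ((r * n * (σ i : ℕ) + r * (υ j : ℕ) : ℕ) : ZMod (r * n ^ 2))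
              - ((r * n * (σ i' : ℕ) + (r - 1) * (τ k : ℕ) : ℕ) : ZMod (r * n ^ 2))
        then sgn (α i') * sgn (γ k) * A i' k * (sgn (γ l) * sgn (β j') * B l j') else 0)
      = sgn (α i') * (sgn (β j') * (sgn (γ k) * sgn (γ l) *
          (wInd n r (σ i) (σ i') (τ k) (τ l) (υ j) (υ j') * (A i' k * B l j'))))
        + (if i' = i then (if j' = j then (if l = k then
            sgn (α i) * sgn (β j) * (A i k * B k j) else 0) else 0) else 0) := by
    intro i' k l j'
    have hc : (((r * (υ j' : ℕ) : ℕ) : ZMod (r * n ^ 2))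
              - (((r - 1) * (τ l : ℕ) : ℕ) : ZMod (r * n ^ 2))
            = ((r * n * (σ i : ℕ) + r * (υ j : ℕ) : ℕ) : ZMod (r * n ^ 2))
              - ((r * n * (σ i' : ℕ) + (r - 1) * (τ k : ℕ) : ℕ) : ZMod (r * n ^ 2)))
        ↔ Coll n r (σ i) (σ i') (τ k) (τ l) (υ j) (υ j') := by
      unfold Coll
      rw [Nat.cast_add, Nat.cast_add]
      constructor <;> intro h <;> linear_combination h
    simp only [hc]
    by_cases hkl : l = k
    · subst hkl
      simp only [coll_diag hr, wInd, EmbeddingLike.apply_eq_iff_eq]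
      by_cases h1 : i' = i
      · by_cases h2 : j' = j
        · subst h1 h2
          simp only [and_self, if_true, ne_eq, not_true_eq_false, and_false, if_false]
          linear_combination (sgn (α i') * sgn (β j') * A i' l * B l j') * sgn_mul_self' (γ l)
        · simp [h2]
      · simp [h1]
    · have : τ k ≠ τ l := fun h => hkl (τ.injective h).symm
      simp only [wInd, hkl, this, if_false, ite_self, add_zero, ne_eq, not_false_eq_true, and_true]
      split_ifs <;> ring
  simp only [Fintype.sum_prod_type, e1, Finset.sum_add_distrib]
  have e2 : ∑ i', ∑ k, ∑ l, ∑ j', (if i' = i then (if j' = j then (if l = k then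
            sgn (α i) * sgn (β j) * (A i k * B k j) else 0) else 0) else 0)
      = sgn (α i) * sgn (β j) * ∑ k, A i k * B k j := by
    rw [Finset.sum_eq_single i]
    · simp [Finset.mul_sum]
    · intro b _ hb; simp [hb]
    · simp
  rw [e2, mul_add]
  have e3 : sgn (α i) * sgn (β j) * (sgn (α i) * sgn (β j) * ∑ k, A i k * B k j)
      = ∑ k, A i k * B k j := by
    rw [← mul_assoc, mul_mul_mul_comm, sgn_mul_self', sgn_mul_self', one_mul, one_mul]
  rw [e3, add_sub_cancel_right]
  congr 1
  refine Finset.sum_congr rfl fun i' _ => ?_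
  simp_rw [Finset.mul_sum]
  rw [Finset.sum_comm_cycle]

end PF

open Finset PF in
/-- There is an absolute constant `C₀` such that for all `2 ≤ r ≤ n` and
all `A, B ∈ ℝ^{n×n}`, the randomized PolyForm algorithm over `ℤ_{rn²}` (with uniformly
random independent permutations `σ, τ, υ` and sign vectors `α, β, γ`) satisfies
`E[‖C − AB‖_F²] ≤ C₀ ((ρ_{n,G}(S,T,U) − n³)/n⁴) ‖A‖_F² ‖B‖_F²`. -/
theorem statement3 : ∃ C₀ : ℝ, 0 < C₀ ∧
    ∀ (n r : ℕ) [NeZero (r * n ^ 2)], 2 ≤ n → 2 ≤ r → r ≤ n →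
    ∀ A B : Fin n → Fin n → ℝ,
    (∑ ω : (Equiv.Perm (Fin n) × Equiv.Perm (Fin n) × Equiv.Perm (Fin n)) ×
        ((Fin n → Bool) × (Fin n → Bool) × (Fin n → Bool)),
      ∑ i : Fin n, ∑ j : Fin n,
        (polyFormC n r A B ω.1.1 ω.1.2.1 ω.1.2.2 ω.2.1 ω.2.2.1 ω.2.2.2 i j
          - ∑ k : Fin n, A i k * B k j) ^ 2)
      / (Fintype.card ((Equiv.Perm (Fin n) × Equiv.Perm (Fin n) × Equiv.Perm (Fin n)) ×
          ((Fin n → Bool) × (Fin n → Bool) × (Fin n → Bool))) : ℝ)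
    ≤ C₀ * (((rhoSTU n r : ℝ) - (n : ℝ) ^ 3) / (n : ℝ) ^ 4) *
        ((∑ i : Fin n, ∑ k : Fin n, A i k ^ 2) * (∑ k : Fin n, ∑ j : Fin n, B k j ^ 2)) := by
  refine ⟨4, by norm_num, ?_⟩
  intro n r _ hn hr hrn A B
  classical
  set R : ℝ := (rhoSTU n r : ℝ) - (n : ℝ) ^ 3 with hR
  have hn0 : (2:ℝ) ≤ n := by exact_mod_cast hn
  have hw0 : ∀ a a' b b' c c', 0 ≤ wInd n r a a' b b' c c' := by
    intro a a' b b' c c'; unfold wInd; split_ifs <;> norm_num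
  have hww : ∀ a a' b b' c c', wInd n r a a' b b' c c' ^ 2 = wInd n r a a' b b' c c' := by
    intro a a' b b' c c'; unfold wInd; split_ifs <;> norm_num
  have hwd : ∀ a a' b c c', wInd n r a a' b b c c' = 0 := by
    intro a a' b c c'; simp [wInd]
  have hR0 : 0 ≤ R := by
    rw [hR, ← rho_ge n r hr]
    refine Finset.sum_nonneg fun _ _ => Finset.sum_nonneg fun _ _ => Finset.sum_nonneg fun _ _ =>
      Finset.sum_nonneg fun _ _ => Finset.sum_nonneg fun _ _ => Finset.sum_nonneg fun _ _ =>
      hw0 _ _ _ _ _ _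
  -- the sign bound
  have hsign : ∀ (σ τ υ : Equiv.Perm (Fin n)) (i j : Fin n),
      ∑ α : Fin n → Bool, ∑ β : Fin n → Bool, ∑ γ : Fin n → Bool,
        (polyFormC n r A B σ τ υ α β γ i j - ∑ k : Fin n, A i k * B k j) ^ 2
      ≤ 2 * (2 ^ n) ^ 3 * ∑ i', ∑ j', ∑ k, ∑ l,
        wInd n r (σ i) (σ i') (τ k) (τ l) (υ j) (υ j') * (A i' k ^ 2 * B l j' ^ 2) := by
    intro σ τ υ i j
    have h := sign_avg (fun i' k l j' =>
      wInd n r (σ i) (σ i') (τ k) (τ l) (υ j) (υ j') * (A i' k * B l j')) (by simp [hwd])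
    simp_rw [mul_pow, hww] at h
    refine le_trans (le_of_eq ?_) h
    refine Finset.sum_congr rfl fun α _ => Finset.sum_congr rfl fun β _ =>
      Finset.sum_congr rfl fun γ _ => ?_
    rw [err_eq n r hr, mul_pow]
    have : (sgn (α i) * sgn (β j)) ^ 2 = 1 := by
      rw [sq, mul_mul_mul_comm, sgn_mul_self', sgn_mul_self', one_mul]
    rw [this, one_mul]
  -- the permutation bound
  have hperm : ∀ i' k l j' : Fin n,
      ∑ σ : Equiv.Perm (Fin n), ∑ τ : Equiv.Perm (Fin n), ∑ υ : Equiv.Perm (Fin n),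
        ∑ i, ∑ j, wInd n r (σ i) (σ i') (τ k) (τ l) (υ j) (υ j')
      ≤ (n.factorial : ℝ) ^ 3 * (2 * R / (n:ℝ) ^ 4) := by
    intro i' k l j'
    by_cases hkl : k = l
    · subst hkl
      simp only [hwd, Finset.sum_const_zero]
      positivity
    · have h := perm_avg (wInd n r) hwd i' k l j' hkl
      rw [rho_ge n r hr] at h
      set Z := ∑ σ : Equiv.Perm (Fin n), ∑ τ : Equiv.Perm (Fin n), ∑ υ : Equiv.Perm (Fin n),
        ∑ i, ∑ j, wInd n r (σ i) (σ i') (τ k) (τ l) (υ j) (υ j') with hZ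
      have hZ0 : 0 ≤ Z := by
        refine Finset.sum_nonneg fun _ _ => Finset.sum_nonneg fun _ _ => Finset.sum_nonneg
          fun _ _ => Finset.sum_nonneg fun _ _ => Finset.sum_nonneg fun _ _ => hw0 _ _ _ _ _ _
      have hp : (0:ℝ) < (n:ℝ) ^ 4 := by positivity
      rw [← mul_div_assoc, le_div_iff₀ hp]
      have h3 : (n:ℝ) ^ 4 ≤ 2 * ((n:ℝ) ^ 3 * ((n:ℝ) - 1)) := by
        have : (0:ℝ) ≤ (n:ℝ) ^ 3 := by positivity
        nlinarith
      nlinarith [mul_le_mul_of_nonneg_left h3 hZ0]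
  -- assemble
  have hcard : (Fintype.card ((Equiv.Perm (Fin n) × Equiv.Perm (Fin n) × Equiv.Perm (Fin n)) ×
          ((Fin n → Bool) × (Fin n → Bool) × (Fin n → Bool))) : ℝ)
      = (n.factorial : ℝ) ^ 3 * (2 ^ n) ^ 3 := by
    simp [Fintype.card_prod, Fintype.card_perm]
    ring
  rw [hcard, div_le_iff₀ (by positivity)]
  have step1 : (∑ ω : (Equiv.Perm (Fin n) × Equiv.Perm (Fin n) × Equiv.Perm (Fin n)) ×
        ((Fin n → Bool) × (Fin n → Bool) × (Fin n → Bool)),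
      ∑ i : Fin n, ∑ j : Fin n,
        (polyFormC n r A B ω.1.1 ω.1.2.1 ω.1.2.2 ω.2.1 ω.2.2.1 ω.2.2.2 i j
          - ∑ k : Fin n, A i k * B k j) ^ 2)
      ≤ ∑ ω : Equiv.Perm (Fin n) × Equiv.Perm (Fin n) × Equiv.Perm (Fin n),
        ∑ i : Fin n, ∑ j : Fin n, 2 * (2 ^ n) ^ 3 * ∑ i', ∑ j', ∑ k, ∑ l,
        wInd n r (ω.1 i) (ω.1 i') (ω.2.1 k) (ω.2.1 l) (ω.2.2 j) (ω.2.2 j')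
          * (A i' k ^ 2 * B l j' ^ 2) := by
    rw [Fintype.sum_prod_type]
    refine Finset.sum_le_sum fun ω _ => ?_
    rw [Finset.sum_comm]
    refine Finset.sum_le_sum fun i _ => ?_
    rw [Finset.sum_comm]
    refine Finset.sum_le_sum fun j _ => ?_
    simp_rw [Fintype.sum_prod_type]
    exact hsign ω.1 ω.2.1 ω.2.2 i j
  refine step1.trans ?_
  have step2 : ∑ ω : Equiv.Perm (Fin n) × Equiv.Perm (Fin n) × Equiv.Perm (Fin n),
        ∑ i : Fin n, ∑ j : Fin n, 2 * (2 ^ n) ^ 3 * ∑ i', ∑ j', ∑ k, ∑ l,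
        wInd n r (ω.1 i) (ω.1 i') (ω.2.1 k) (ω.2.1 l) (ω.2.2 j) (ω.2.2 j')
          * (A i' k ^ 2 * B l j' ^ 2)
      = 2 * (2 ^ n) ^ 3 * ∑ q : Fin n × Fin n × Fin n × Fin n,
        (∑ σ : Equiv.Perm (Fin n), ∑ τ : Equiv.Perm (Fin n), ∑ υ : Equiv.Perm (Fin n),
        ∑ i, ∑ j, wInd n r (σ i) (σ q.1) (τ q.2.2.1) (τ q.2.2.2) (υ j) (υ q.2.1)) *
          (A q.1 q.2.2.1 ^ 2 * B q.2.2.2 q.2.1 ^ 2) := by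
    simp_rw [← Finset.mul_sum]
    congr 1
    have : ∀ q : Fin n × Fin n × Fin n × Fin n,
        (∑ σ : Equiv.Perm (Fin n), ∑ τ : Equiv.Perm (Fin n), ∑ υ : Equiv.Perm (Fin n),
        ∑ i, ∑ j, wInd n r (σ i) (σ q.1) (τ q.2.2.1) (τ q.2.2.2) (υ j) (υ q.2.1))
        = ∑ ω : Equiv.Perm (Fin n) × Equiv.Perm (Fin n) × Equiv.Perm (Fin n),
          ∑ z : Fin n × Fin n, wInd n r (ω.1 z.1) (ω.1 q.1) (ω.2.1 q.2.2.1) (ω.2.1 q.2.2.2)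
            (ω.2.2 z.2) (ω.2.2 q.2.1) := by
      intro q
      simp_rw [Fintype.sum_prod_type]
    simp_rw [this, Finset.sum_mul]
    refine Eq.trans ?_ Finset.sum_comm
    refine Finset.sum_congr rfl fun ω _ => ?_
    refine Eq.trans ?_ Finset.sum_comm
    simp_rw [Fintype.sum_prod_type]
  rw [step2]
  have step3 : ∑ q : Fin n × Fin n × Fin n × Fin n,
        (∑ σ : Equiv.Perm (Fin n), ∑ τ : Equiv.Perm (Fin n), ∑ υ : Equiv.Perm (Fin n),
        ∑ i, ∑ j, wInd n r (σ i) (σ q.1) (τ q.2.2.1) (τ q.2.2.2) (υ j) (υ q.2.1)) *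
          (A q.1 q.2.2.1 ^ 2 * B q.2.2.2 q.2.1 ^ 2)
      ≤ ∑ q : Fin n × Fin n × Fin n × Fin n, (n.factorial : ℝ) ^ 3 * (2 * R / (n:ℝ) ^ 4) *
          (A q.1 q.2.2.1 ^ 2 * B q.2.2.2 q.2.1 ^ 2) :=
    Finset.sum_le_sum fun q _ =>
      mul_le_mul_of_nonneg_right (hperm q.1 q.2.2.1 q.2.2.2 q.2.1) (by positivity)
  have step4 : ∑ q : Fin n × Fin n × Fin n × Fin n, (A q.1 q.2.2.1 ^ 2 * B q.2.2.2 q.2.1 ^ 2)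
      = (∑ i : Fin n, ∑ k : Fin n, A i k ^ 2) * (∑ k : Fin n, ∑ j : Fin n, B k j ^ 2) := by
    simp_rw [Fintype.sum_prod_type]
    rw [Finset.sum_mul]
    refine Finset.sum_congr rfl fun i _ => ?_
    rw [Finset.sum_comm (f := fun k j : Fin n => B k j ^ 2), Finset.mul_sum]
    refine Finset.sum_congr rfl fun j _ => ?_
    rw [Finset.sum_mul_sum]
  rw [← Finset.mul_sum, step4] at step3
  calc _ ≤ 2 * (2 ^ n) ^ 3 * ((n.factorial : ℝ) ^ 3 * (2 * R / (n:ℝ) ^ 4) *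
      ((∑ i : Fin n, ∑ k : Fin n, A i k ^ 2) * (∑ k : Fin n, ∑ j : Fin n, B k j ^ 2))) := by
        gcongr
    _ = _ := by ring
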